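/- There exist constants Θ ≥ 1 and γ₀, γ₁ > 0 such that the following holds. Let κ, T₁, T₂ > 0 with κ²T₁ ≥ Θ, T₂ ≥ T₁, T₂ ≥ √(T₁T₂)(1 + γ₀(κ²T₁)^{−1/4}) and T₁ ≤ √(T₁T₂)(1 − γ₁(κ²T₁)^{−1/4}). Let ρ : [0,1] → (0,∞) be measurable and bounded with ∫₀¹ ρ = 1, let T : [0,1] → (0,∞) be measurable with T₁ ≤ T(y) ≤ T₂ for all y, let f be a mild steady state of the linear BGK equation with data (κ, T₁, T₂, ρ, T), and assume in addition that the pressure P(x) = ∫_ℝ v² f(x,v) dv is constant in x. Define the output temperature profile τ(x) = P(x)/ρ(x). Then T₁ ≤ τ(x) ≤ T₂ for all x ∈ [0,1]; i.e. the interval of temperatures [T₁,T₂] is preserved by the map T ↦ τ. -/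

import Mathlib

open MeasureTheory Real Set

/-- Centered Maxwellian with temperature `T`: `M_T(v) = (2πT)^{-1/2} exp(−v²/(2T))`. -/
noncomputable def Mxw (T v : ℝ) : ℝ :=
  (Real.sqrt (2 * π * T))⁻¹ * Real.exp (-v ^ 2 / (2 * T))

/-- Wall Maxwellian with temperature `T`: `M̃_T(v) = (1/T) exp(−v²/(2T))`,
normalized so that `∫₀^∞ v M̃_T(v) dv = 1`. -/
noncomputable def wallMxw (T v : ℝ) : ℝ :=
  T⁻¹ * Real.exp (-v ^ 2 / (2 * T))

/-- `C_i = ∫₀^∞ v e^{−1/(κv)} M̃_{T_i}(v) dv`. -/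
noncomputable def Cwall (κ T : ℝ) : ℝ :=
  ∫ v in Ioi (0 : ℝ), v * Real.exp (-1 / (κ * v)) * wallMxw T v

/-- `C₋ = (1/κ) ∫₀¹ ρ(y) (∫₀^∞ e^{−y/(κv)} M_{T(y)}(v) dv) dy`. -/
noncomputable def Cminus (κ : ℝ) (ρ T : ℝ → ℝ) : ℝ :=
  κ⁻¹ * ∫ y in Icc (0 : ℝ) 1, ρ y * ∫ v in Ioi (0 : ℝ), Real.exp (-y / (κ * v)) * Mxw (T y) v

/-- `C₊ = (1/κ) ∫₀¹ ρ(y) (∫₀^∞ e^{−(1−y)/(κv)} M_{T(y)}(v) dv) dy`. -/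
noncomputable def Cplus (κ : ℝ) (ρ T : ℝ → ℝ) : ℝ :=
  κ⁻¹ * ∫ y in Icc (0 : ℝ) 1, ρ y * ∫ v in Ioi (0 : ℝ), Real.exp (-(1 - y) / (κ * v)) * Mxw (T y) v

/-- `f` is a mild steady state of the linear BGK equation with data `(κ, T₁, T₂, ρ, T)`. -/
def IsMildSteadyState (κ T₁ T₂ : ℝ) (ρ T : ℝ → ℝ) (f : ℝ → ℝ → ℝ) : Prop :=
  Cwall κ T₁ * Cwall κ T₂ < 1 ∧
  IntegrableOn
    (fun y => ρ y * ∫ v in Ioi (0 : ℝ), Real.exp (-y / (κ * v)) * Mxw (T y) v)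
    (Icc (0 : ℝ) 1) ∧
  IntegrableOn
    (fun y => ρ y * ∫ v in Ioi (0 : ℝ), Real.exp (-(1 - y) / (κ * v)) * Mxw (T y) v)
    (Icc (0 : ℝ) 1) ∧
  (∀ x ∈ Icc (0 : ℝ) 1, ρ x = ∫ v, f x v) ∧
  (∀ x ∈ Icc (0 : ℝ) 1,
    (∀ᵐ v ∂(volume.restrict (Ioi (0 : ℝ))),
      f x v = Real.exp (-x / (κ * v)) * wallMxw T₁ v *
          ((Cminus κ ρ T + Cwall κ T₂ * Cplus κ ρ T) / (1 - Cwall κ T₁ * Cwall κ T₂)) +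
        ∫ y in (0 : ℝ)..x, (κ * v)⁻¹ * Real.exp (-(x - y) / (κ * v)) * ρ y * Mxw (T y) v) ∧
    (∀ᵐ v ∂(volume.restrict (Iio (0 : ℝ))),
      f x v = Real.exp (-(1 - x) / (κ * |v|)) * wallMxw T₂ v *
          ((Cplus κ ρ T + Cwall κ T₁ * Cminus κ ρ T) / (1 - Cwall κ T₁ * Cwall κ T₂)) +
        ∫ y in x..1, (κ * |v|)⁻¹ * Real.exp (-(y - x) / (κ * |v|)) * ρ y * Mxw (T y) v))


lemma wallMxw_sq_eq (t v : ℝ) :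
    wallMxw (t ^ 2) v = (t ^ 2)⁻¹ * exp (-(2 * t ^ 2)⁻¹ * v ^ 2) := by
  rw [wallMxw]; congr 2; ring

lemma wallMxw_nonneg {T : ℝ} (hT : 0 < T) (v : ℝ) : 0 ≤ wallMxw T v := by
  unfold wallMxw; positivity

lemma wallMxw_neg (T v : ℝ) : wallMxw T (-v) = wallMxw T v := by
  simp [wallMxw]

lemma wallMxw_le {T : ℝ} (hT : 0 < T) (v : ℝ) : wallMxw T v ≤ T⁻¹ := by
  unfold wallMxw
  refine mul_le_of_le_one_right (by positivity) (exp_le_one_iff.2 ?_)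
  exact div_nonpos_of_nonpos_of_nonneg (by nlinarith [sq_nonneg v]) (by positivity)

lemma integrableOn_wallMxw {t : ℝ} (ht : 0 < t) :
    IntegrableOn (fun v => wallMxw (t ^ 2) v) (Ioi 0) := by
  simp_rw [wallMxw_sq_eq]
  exact ((integrable_exp_neg_mul_sq (b := (2 * t ^ 2)⁻¹) (by positivity)).const_mul _).integrableOn

lemma integral_wallMxw {t : ℝ} (ht : 0 < t) :
    ∫ v in Ioi (0 : ℝ), wallMxw (t ^ 2) v = √(π / 2) / t := by
  simp_rw [wallMxw_sq_eq]
  rw [integral_const_mul, integral_gaussian_Ioi]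
  have : π / (2 * t ^ 2)⁻¹ = (π / 2) * (2 * t) ^ 2 := by field_simp
  rw [this, sqrt_mul (by positivity), sqrt_sq (by positivity)]
  field_simp

lemma integrableOn_pow_mul_wallMxw {t : ℝ} (ht : 0 < t) (n : ℕ) :
    IntegrableOn (fun v => v ^ n * wallMxw (t ^ 2) v) (Ioi 0) := by
  have h := (integrableOn_rpow_mul_exp_neg_mul_sq (b := (2 * t ^ 2)⁻¹) (by positivity)
    (s := n) (by have : (0 : ℝ) ≤ n := n.cast_nonneg; linarith)).const_mul ((t ^ 2)⁻¹)
  refine IntegrableOn.congr_fun h (fun v _ => ?_) measurableSet_Ioi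
  simp only [wallMxw_sq_eq, rpow_natCast]
  ring

lemma integral_pow_mul_wallMxw {t : ℝ} (ht : 0 < t) (n : ℕ) :
    ∫ v in Ioi (0 : ℝ), v ^ n * wallMxw (t ^ 2) v =
      (t ^ 2)⁻¹ * ((2 * t ^ 2)⁻¹ ^ (-((n : ℝ) + 1) / 2) * (1 / 2) * Gamma (((n : ℝ) + 1) / 2)) := by
  rw [← integral_rpow_mul_exp_neg_mul_rpow (p := 2) (q := n) (by norm_num)
    (by have : (0 : ℝ) ≤ n := n.cast_nonneg; linarith) (by positivity), ← integral_const_mul]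
  refine setIntegral_congr_fun measurableSet_Ioi (fun v _ => ?_)
  simp only [wallMxw_sq_eq, rpow_natCast, rpow_ofNat]
  ring

lemma integral_id_mul_wallMxw {t : ℝ} (ht : 0 < t) :
    ∫ v in Ioi (0 : ℝ), v * wallMxw (t ^ 2) v = 1 := by
  have h := integral_pow_mul_wallMxw ht 1
  simp only [pow_one] at h
  rw [h]
  norm_num
  rw [rpow_neg_one]
  field_simp

lemma integral_sq_mul_wallMxw {t : ℝ} (ht : 0 < t) :
    ∫ v in Ioi (0 : ℝ), v ^ 2 * wallMxw (t ^ 2) v = √(π / 2) * t := by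
  rw [integral_pow_mul_wallMxw ht 2]
  have hG : Gamma (3 / 2) = √π / 2 := by
    rw [show (3 / 2 : ℝ) = 1 / 2 + 1 by norm_num, Gamma_add_one (by norm_num), Gamma_one_half_eq]
    ring
  have h1 : ((2 * t ^ 2)⁻¹ : ℝ) ^ (-(3 / 2) : ℝ) = 2 * t ^ 2 * (√2 * t) := by
    rw [inv_rpow (by positivity), rpow_neg (by positivity), inv_inv,
      show (3 / 2 : ℝ) = 1 + 1 / 2 by norm_num, rpow_add (by positivity), rpow_one,
      ← sqrt_eq_rpow, sqrt_mul (by norm_num), sqrt_sq ht.le]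
  have h2 : √2 * √2 = 2 := mul_self_sqrt (by norm_num)
  norm_num
  rw [show (2 * t ^ 2)⁻¹ = (t ^ 2)⁻¹ * (1 / 2) by rw [mul_inv]; ring] at h1
  rw [h1, hG]
  field_simp
  linear_combination h2

lemma one_le_sqrt_pi_div_two : 1 ≤ √(π / 2) := by
  rw [one_le_sqrt]; linarith [pi_gt_three]

lemma sqrt_pi_div_two_le_two : √(π / 2) ≤ 2 := by
  rw [sqrt_le_left (by norm_num)]; linarith [pi_lt_four]

lemma one_sub_exp_neg_div_le {κ x v : ℝ} (hκ : 0 < κ) (hx1 : x ≤ 1) (hv : 0 < v) :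
    1 - exp (-x / (κ * v)) ≤ κ⁻¹ / v := by
  have h := add_one_le_exp (-x / (κ * v))
  have : x / (κ * v) ≤ κ⁻¹ / v := by
    rw [show κ⁻¹ / v = 1 / (κ * v) by field_simp]
    gcongr
  rw [neg_div] at *
  linarith

lemma exp_neg_div_le_one {κ x v : ℝ} (hκ : 0 < κ) (hx0 : 0 ≤ x) (hv : 0 < v) :
    exp (-x / (κ * v)) ≤ 1 := by
  rw [exp_le_one_iff, neg_div, neg_nonpos]; positivity

lemma Cwall_ge {κ t : ℝ} (hκ : 0 < κ) (ht : 0 < t) :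
    1 - κ⁻¹ * (√(π / 2) / t) ≤ Cwall κ (t ^ 2) := by
  rw [← integral_id_mul_wallMxw ht, ← integral_wallMxw ht, ← integral_const_mul]
  have hi := integrableOn_pow_mul_wallMxw ht 1
  simp only [pow_one] at hi
  rw [← integral_sub hi ((integrableOn_wallMxw ht).const_mul _)]
  refine setIntegral_mono_on (hi.sub ((integrableOn_wallMxw ht).const_mul _)) ?_
    measurableSet_Ioi fun v hv => ?_
  · refine hi.mono' (Measurable.aestronglyMeasurable (by unfold wallMxw; fun_prop)) ?_
    filter_upwards [ae_restrict_mem measurableSet_Ioi] with v hv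
    have hv : 0 < v := hv
    have hw := wallMxw_nonneg (pow_pos ht 2) v
    rw [norm_of_nonneg (by positivity)]
    have := exp_neg_div_le_one hκ zero_le_one hv
    gcongr
    exact mul_le_of_le_one_right hv.le this
  · have hv : 0 < v := hv
    have hw := wallMxw_nonneg (pow_pos ht 2) v
    have h := mul_le_mul_of_nonneg_right
      (mul_le_mul_of_nonneg_left (one_sub_exp_neg_div_le hκ le_rfl hv) hv.le) hw
    rw [mul_div_cancel₀ _ hv.ne'] at h
    linarith

lemma Cwall_nonneg {κ T : ℝ} (hT : 0 < T) : 0 ≤ Cwall κ T :=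
  setIntegral_nonneg measurableSet_Ioi fun v hv => by
    have : (0 : ℝ) < v := hv
    have := wallMxw_nonneg hT v
    positivity

lemma Mxw_nonneg (T v : ℝ) : 0 ≤ Mxw T v := by unfold Mxw; positivity

lemma Mxw_neg (T v : ℝ) : Mxw T (-v) = Mxw T v := by simp [Mxw]

lemma Mxw_le_inv {a T : ℝ} (ha : 0 < a) (hT : a ^ 2 ≤ T) (v : ℝ) : Mxw T v ≤ a⁻¹ := by
  have hT0 : 0 < T := lt_of_lt_of_le (by positivity) hT
  have h1 : exp (-v ^ 2 / (2 * T)) ≤ 1 := exp_le_one_iff.2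
    (div_nonpos_of_nonpos_of_nonneg (by nlinarith [sq_nonneg v]) (by positivity))
  have h2 : a ≤ √(2 * π * T) := le_sqrt_of_sq_le (by nlinarith [pi_gt_three])
  calc Mxw T v ≤ (√(2 * π * T))⁻¹ * 1 := by unfold Mxw; gcongr
    _ ≤ a⁻¹ := by rw [mul_one]; gcongr

lemma Mxw_le_inv_mul_exp {b T v : ℝ} (hT0 : 0 < T) (hT : T ≤ b ^ 2) (hv : 0 < v) :
    Mxw T v ≤ v⁻¹ * exp (-v ^ 2 / (4 * b ^ 2)) := by
  have h1 : v / √(2 * π * T) ≤ exp (v ^ 2 / (4 * T)) := by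
    have hs : 0 < √(2 * π * T) := by positivity
    rw [div_le_iff₀ hs]
    have h2 : √(2 * T) ≤ √(2 * π * T) := sqrt_le_sqrt (by nlinarith [pi_gt_three])
    have h3 := add_one_le_exp (v ^ 2 / (4 * T))
    have h4 : v ≤ (v ^ 2 / (4 * T) + 1) * √(2 * T) := by
      have h5 : 0 < √(2 * T) := by positivity
      have h6 : √(2 * T) ^ 2 = 2 * T := sq_sqrt (by positivity)
      rw [show 4 * T = 2 * √(2 * T) ^ 2 by rw [h6]; ring]
      have : (v ^ 2 / (2 * √(2 * T) ^ 2) + 1) * √(2 * T) - v =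
          ((v - √(2 * T)) ^ 2 + √(2 * T) ^ 2) / (2 * √(2 * T)) := by field_simp; ring
      have h7 : 0 ≤ ((v - √(2 * T)) ^ 2 + √(2 * T) ^ 2) / (2 * √(2 * T)) := by positivity
      linarith
    exact h4.trans (by gcongr)
  have h2 : exp (-v ^ 2 / (4 * T)) ≤ exp (-v ^ 2 / (4 * b ^ 2)) := by
    rw [exp_le_exp, neg_div, neg_div, neg_le_neg_iff]; gcongr
  have h3 : Mxw T v = v⁻¹ * ((v / √(2 * π * T)) * exp (-v ^ 2 / (2 * T))) := by
    unfold Mxw; field_simp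
  rw [h3]
  gcongr
  calc _ ≤ exp (v ^ 2 / (4 * T)) * exp (-v ^ 2 / (2 * T)) := by gcongr
    _ = exp (-v ^ 2 / (4 * T)) := by rw [← exp_add]; congr 1; field_simp; ring
    _ ≤ _ := h2

lemma integral_attenuation_left (κ v x : ℝ) :
    ∫ y in (0 : ℝ)..x, (κ * v)⁻¹ * exp (-(x - y) / (κ * v)) = 1 - exp (-x / (κ * v)) := by
  have hd : ∀ y ∈ uIcc 0 x, HasDerivAt (fun y => exp (-(x - y) / (κ * v)))
      ((κ * v)⁻¹ * exp (-(x - y) / (κ * v))) y := fun y _ => by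
    have h : HasDerivAt (fun y => -(x - y) / (κ * v)) (κ * v)⁻¹ y := by
      simpa using (((hasDerivAt_id' y).const_sub x).fun_neg).div_const (κ * v)
    simpa only [mul_comm] using h.exp
  rw [intervalIntegral.integral_eq_sub_of_hasDerivAt hd
    (Continuous.intervalIntegrable (by fun_prop) _ _)]
  simp

lemma integral_attenuation_right (κ v x : ℝ) :
    ∫ y in x..1, (κ * v)⁻¹ * exp (-(y - x) / (κ * v)) = 1 - exp (-(1 - x) / (κ * v)) := by
  have hd : ∀ y ∈ uIcc x 1, HasDerivAt (fun y => -exp (-(y - x) / (κ * v)))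
      ((κ * v)⁻¹ * exp (-(y - x) / (κ * v))) y := fun y _ => by
    have h : HasDerivAt (fun y => -(y - x) / (κ * v)) (-(κ * v)⁻¹) y := by
      simpa [neg_div] using (((hasDerivAt_id' y).sub_const x).fun_neg).div_const (κ * v)
    simpa only [mul_comm, mul_neg, neg_mul, neg_neg] using h.exp.fun_neg
  rw [intervalIntegral.integral_eq_sub_of_hasDerivAt hd
    (Continuous.intervalIntegrable (by fun_prop) _ _)]
  simp; ring

lemma integral_source_bounds {p q R G : ℝ} {k ρ M : ℝ → ℝ} (hpq : p ≤ q)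
    (hk : Continuous k) (hk0 : ∀ y, 0 ≤ k y)
    (hρ0 : ∀ y ∈ Icc p q, 0 ≤ ρ y) (hρ : ∀ y ∈ Icc p q, ρ y ≤ R)
    (hM0 : ∀ y, 0 ≤ M y) (hM : ∀ y ∈ Icc p q, M y ≤ G) :
    0 ≤ ∫ y in p..q, k y * ρ y * M y ∧
      ∫ y in p..q, k y * ρ y * M y ≤ R * G * ∫ y in p..q, k y := by
  have h0 : ∀ y ∈ Icc p q, 0 ≤ k y * ρ y * M y := fun y hy =>
    mul_nonneg (mul_nonneg (hk0 y) (hρ0 y hy)) (hM0 y)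
  refine ⟨intervalIntegral.integral_nonneg hpq h0, ?_⟩
  rw [← intervalIntegral.integral_const_mul, intervalIntegral.integral_of_le hpq,
    intervalIntegral.integral_of_le hpq]
  refine integral_mono_of_nonneg ?_ ?_ ?_
  · filter_upwards [ae_restrict_mem measurableSet_Ioc] with y hy
    exact h0 y (Ioc_subset_Icc_self hy)
  · exact (Continuous.intervalIntegrable (by fun_prop) p q).1
  · filter_upwards [ae_restrict_mem measurableSet_Ioc] with y hy
    have hy := Ioc_subset_Icc_self hy
    have hR : 0 ≤ R := (hρ0 y hy).trans (hρ y hy)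
    calc k y * ρ y * M y ≤ k y * R * G := by
          have := hk0 y; have := hM0 y
          gcongr
          exacts [hρ y hy, hM y hy]
      _ = R * G * k y := by ring

lemma one_sub_exp_le_indicator {κ a x v δ : ℝ} (hκ : 0 < κ) (hδ : 0 < δ)
    (hκδ : κ⁻¹ = a * δ ^ 2) (hx1 : x ≤ 1) (hv : 0 < v) :
    1 - exp (-x / (κ * v)) ≤ (Ioc 0 (δ * a)).indicator 1 v + δ := by
  by_cases h : v ≤ δ * a
  · rw [indicator_of_mem (show v ∈ Ioc 0 (δ * a) from ⟨hv, h⟩), Pi.one_apply]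
    linarith [exp_pos (-x / (κ * v))]
  · rw [indicator_of_notMem (fun h' => h h'.2), zero_add]
    refine (one_sub_exp_neg_div_le hκ hx1 hv).trans ?_
    rw [div_le_iff₀ hv, hκδ]
    nlinarith

lemma integrable_indicator_Ioc_one {c : ℝ} :
    IntegrableOn ((Ioc 0 c).indicator (1 : ℝ → ℝ)) (Ioi 0) :=
  ((integrable_indicator_iff measurableSet_Ioc).2
    (integrableOn_const (by simp))).integrableOn

lemma integral_indicator_Ioc_one {c : ℝ} (hc : 0 ≤ c) :
    ∫ v in Ioi (0 : ℝ), (Ioc 0 c).indicator (1 : ℝ → ℝ) v = c := by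
  rw [setIntegral_indicator measurableSet_Ioc, inter_eq_right.2 Ioc_subset_Ioi_self]
  simp [hc]

lemma integrable_indicator_Ioi_rpow {a : ℝ} (ha : 0 < a) :
    IntegrableOn ((Ioi a).indicator (fun v : ℝ => v ^ (-2 : ℝ))) (Ioi 0) :=
  ((integrable_indicator_iff measurableSet_Ioi).2
    (integrableOn_Ioi_rpow_of_lt (by norm_num) ha)).integrableOn

lemma integral_indicator_Ioi_rpow {a : ℝ} (ha : 0 < a) :
    ∫ v in Ioi (0 : ℝ), (Ioi a).indicator (fun v : ℝ => v ^ (-2 : ℝ)) v = a⁻¹ := by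
  rw [setIntegral_indicator measurableSet_Ioi, inter_eq_right.2 (Ioi_subset_Ioi ha.le),
    integral_Ioi_rpow_of_lt (by norm_num) ha]
  norm_num [rpow_neg_one]

/-- Half-line density bound. -/
lemma halfline_density_le {κ a t A x R δ : ℝ} (hκ : 0 < κ) (ha : 0 < a) (ht : 0 < t)
    (hδ : 0 < δ) (hδ1 : δ ≤ 1) (hκδ : κ⁻¹ = a * δ ^ 2) (hR : 0 ≤ R) (hx1 : x ≤ 1)
    {F : ℝ → ℝ} (hF : IntegrableOn F (Ioi 0))
    (h₁ : ∀ᵐ v ∂volume.restrict (Ioi 0),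
      F v ≤ A * wallMxw (t ^ 2) v + R * a⁻¹ * (1 - exp (-x / (κ * v))))
    (h₂ : ∀ᵐ v ∂volume.restrict (Ioi 0), F v ≤ A * wallMxw (t ^ 2) v + R * κ⁻¹ / v ^ 2) :
    ∫ v in Ioi 0, F v ≤ A * (√(π / 2) / t) + 3 * R * δ := by
  have hw := (integrableOn_wallMxw ht).const_mul A
  have i₁ := (integrable_indicator_Ioc_one (c := δ * a)).const_mul (R * a⁻¹)
  have i₂ := (integrable_indicator_Ioc_one (c := a)).const_mul (R * a⁻¹ * δ)
  have i₃ := (integrable_indicator_Ioi_rpow ha).const_mul (R * κ⁻¹)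
  have key : ∀ᵐ v ∂volume.restrict (Ioi 0), F v ≤ A * wallMxw (t ^ 2) v +
      R * a⁻¹ * (Ioc 0 (δ * a)).indicator 1 v + R * a⁻¹ * δ * (Ioc 0 a).indicator 1 v +
      R * κ⁻¹ * (Ioi a).indicator (fun v : ℝ => v ^ (-2 : ℝ)) v := by
    filter_upwards [h₁, h₂, ae_restrict_mem measurableSet_Ioi] with v h₁ h₂ hv
    have hv : 0 < v := hv
    by_cases hva : v ≤ a
    · rw [indicator_of_mem (show v ∈ Ioc 0 a from ⟨hv, hva⟩),
        indicator_of_notMem (s := Ioi a) (not_lt.2 hva), Pi.one_apply]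
      have := mul_le_mul_of_nonneg_left
        (one_sub_exp_le_indicator hκ hδ hκδ hx1 hv) (by positivity : 0 ≤ R * a⁻¹)
      linarith
    · have h0 : 0 ≤ R * a⁻¹ * (Ioc 0 (δ * a)).indicator (1 : ℝ → ℝ) v :=
        mul_nonneg (by positivity) (indicator_nonneg (fun _ _ => zero_le_one) _)
      rw [indicator_of_notMem (s := Ioc 0 a) (fun h => hva h.2),
        indicator_of_mem (s := Ioi a) (not_le.1 hva), rpow_neg hv.le, rpow_two]
      rw [div_eq_mul_inv] at h₂
      linarith
  refine (setIntegral_mono_ae_restrict hF (((hw.add i₁).add i₂).add i₃) key).trans ?_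
  simp only [Pi.add_apply]
  rw [integral_add ((hw.fun_add i₁).fun_add i₂) i₃, integral_add (hw.fun_add i₁) i₂,
    integral_add hw i₁, integral_const_mul, integral_const_mul,
    integral_const_mul, integral_const_mul, integral_wallMxw ht,
    integral_indicator_Ioc_one (by positivity), integral_indicator_Ioc_one ha.le,
    integral_indicator_Ioi_rpow ha, hκδ]
  have e : A * (√(π / 2) / t) + R * a⁻¹ * (δ * a) + R * a⁻¹ * δ * a + R * (a * δ ^ 2) * a⁻¹ =
      A * (√(π / 2) / t) + R * (2 * δ + δ ^ 2) := by field_simp; ring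
  rw [e]
  nlinarith [mul_nonneg hR (mul_nonneg hδ.le (sub_nonneg.2 hδ1))]

lemma le_halfline_density {κ a t A x δ : ℝ} (hκ : 0 < κ) (ha : 0 < a) (hat : a ≤ t)
    (hδ : 0 < δ) (hκδ : κ⁻¹ = a * δ ^ 2) (hA : 0 ≤ A) (hx1 : x ≤ 1)
    {F : ℝ → ℝ} (hF : IntegrableOn F (Ioi 0))
    (h₀ : ∀ᵐ v ∂volume.restrict (Ioi 0), exp (-x / (κ * v)) * wallMxw (t ^ 2) v * A ≤ F v) :
    A * (√(π / 2) / t) * (1 - 2 * δ) ≤ ∫ v in Ioi 0, F v := by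
  have ht : 0 < t := ha.trans_le hat
  have hw := (integrableOn_wallMxw ht).const_mul (A * (1 - δ))
  have i₁ := (integrable_indicator_Ioc_one (c := δ * a)).const_mul (A * (t ^ 2)⁻¹)
  have key : ∀ᵐ v ∂volume.restrict (Ioi 0), A * (1 - δ) * wallMxw (t ^ 2) v -
      A * (t ^ 2)⁻¹ * (Ioc 0 (δ * a)).indicator 1 v ≤ F v := by
    filter_upwards [h₀, ae_restrict_mem measurableSet_Ioi] with v h₀ hv
    refine le_trans ?_ h₀
    have h1 := one_sub_exp_le_indicator hκ hδ hκδ hx1 hv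
    have hw0 := wallMxw_nonneg (pow_pos ht 2) v
    have h2 := mul_le_mul_of_nonneg_right (wallMxw_le (pow_pos ht 2) v)
      (indicator_nonneg (s := Ioc 0 (δ * a)) (f := (1 : ℝ → ℝ)) (fun _ _ => zero_le_one) v)
    have h3 := mul_le_mul_of_nonneg_left h1 hw0
    have h4 := mul_le_mul_of_nonneg_left (h3.trans
      ((mul_add _ _ _).trans_le (add_le_add_left h2 _))) hA
    linarith
  refine le_trans ?_ (setIntegral_mono_ae_restrict (hw.sub i₁) hF key)
  simp only [Pi.sub_apply]
  rw [integral_sub hw i₁, integral_const_mul, integral_const_mul, integral_wallMxw ht,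
    integral_indicator_Ioc_one (by positivity)]
  have h1 : (t ^ 2)⁻¹ * (δ * a) ≤ √(π / 2) / t * δ := by
    calc (t ^ 2)⁻¹ * (δ * a) ≤ (t ^ 2)⁻¹ * (δ * t) := by gcongr
      _ = 1 / t * δ := by field_simp
      _ ≤ _ := by gcongr; exact one_le_sqrt_pi_div_two
  have := mul_le_mul_of_nonneg_left h1 hA
  linarith

lemma integrableOn_sq_mul_and_bounds {κ b t A x R : ℝ} (hκ : 0 < κ) (hb : 0 < b) (ht : 0 < t)
    (hA : 0 ≤ A) (hR : 0 ≤ R) (hx1 : x ≤ 1)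
    {F : ℝ → ℝ} (hF : IntegrableOn F (Ioi 0))
    (h₀ : ∀ᵐ v ∂volume.restrict (Ioi 0), exp (-x / (κ * v)) * wallMxw (t ^ 2) v * A ≤ F v)
    (h₂ : ∀ᵐ v ∂volume.restrict (Ioi 0),
      F v ≤ A * wallMxw (t ^ 2) v + R * κ⁻¹ / v ^ 2 * exp (-v ^ 2 / (4 * b ^ 2))) :
    IntegrableOn (fun v => v ^ 2 * F v) (Ioi 0) ∧
      A * (√(π / 2) * t - κ⁻¹) ≤ ∫ v in Ioi 0, v ^ 2 * F v ∧
      ∫ v in Ioi 0, v ^ 2 * F v ≤ A * (√(π / 2) * t) + 2 * R * κ⁻¹ * b := by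
  have hw₂ := (integrableOn_pow_mul_wallMxw ht 2).const_mul A
  have hw₁ := (integrableOn_pow_mul_wallMxw ht 1).const_mul (A * κ⁻¹)
  simp only [pow_one] at hw₁
  have hg := ((integrable_exp_neg_mul_sq (b := (4 * b ^ 2)⁻¹)
    (by positivity)).const_mul (R * κ⁻¹)).integrableOn (s := Ioi 0)
  have up : ∀ᵐ v ∂volume.restrict (Ioi 0), v ^ 2 * F v ≤ A * (v ^ 2 * wallMxw (t ^ 2) v) +
      R * κ⁻¹ * exp (-(4 * b ^ 2)⁻¹ * v ^ 2) := by
    filter_upwards [h₂, ae_restrict_mem measurableSet_Ioi] with v h₂ hv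
    have hv : 0 < v := hv
    have h := mul_le_mul_of_nonneg_left h₂ (sq_nonneg v)
    refine h.trans_eq ?_
    rw [show -(4 * b ^ 2)⁻¹ * v ^ 2 = -v ^ 2 / (4 * b ^ 2) by ring]
    field_simp
  have low : ∀ᵐ v ∂volume.restrict (Ioi 0), A * (v ^ 2 * wallMxw (t ^ 2) v) -
      A * κ⁻¹ * (v * wallMxw (t ^ 2) v) ≤ v ^ 2 * F v := by
    filter_upwards [h₀, ae_restrict_mem measurableSet_Ioi] with v h₀ hv
    have hv : 0 < v := hv
    refine le_trans ?_ (mul_le_mul_of_nonneg_left h₀ (sq_nonneg v))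
    have hw0 := wallMxw_nonneg (pow_pos ht 2) v
    have h := mul_le_mul_of_nonneg_left (one_sub_exp_neg_div_le hκ hx1 hv)
      (by positivity : 0 ≤ A * v ^ 2 * wallMxw (t ^ 2) v)
    have e : A * v ^ 2 * wallMxw (t ^ 2) v * (κ⁻¹ / v) = A * κ⁻¹ * (v * wallMxw (t ^ 2) v) := by
      field_simp
    linarith
  have hi : IntegrableOn (fun v => v ^ 2 * F v) (Ioi 0) := by
    refine (hw₂.add hg).mono'
      ((Continuous.aestronglyMeasurable (by fun_prop)).mul hF.aestronglyMeasurable) ?_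
    filter_upwards [h₀, up, ae_restrict_mem measurableSet_Ioi] with v h₀ hup hv
    have hw0 := wallMxw_nonneg (pow_pos ht 2) v
    have : 0 ≤ F v := le_trans (by positivity) h₀
    rw [norm_of_nonneg (by positivity)]
    exact hup
  refine ⟨hi, ?_, ?_⟩
  · refine le_trans (le_of_eq ?_) (setIntegral_mono_ae_restrict (hw₂.sub hw₁) hi low)
    simp only [Pi.sub_apply]
    rw [integral_sub hw₂ hw₁, integral_const_mul, integral_const_mul, integral_sq_mul_wallMxw ht,
      integral_id_mul_wallMxw ht]
    ring
  · refine (setIntegral_mono_ae_restrict hi (hw₂.add hg) up).trans ?_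
    simp only [Pi.add_apply]
    rw [integral_add hw₂ hg, integral_const_mul, integral_const_mul, integral_sq_mul_wallMxw ht,
      integral_gaussian_Ioi]
    have h1 : √(π / (4 * b ^ 2)⁻¹) / 2 ≤ 2 * b := by
      have : √(π / (4 * b ^ 2)⁻¹) ≤ 4 * b := by
        rw [sqrt_le_left (by positivity), div_inv_eq_mul]
        nlinarith [pi_lt_four, pow_pos hb 2]
      linarith
    have := mul_le_mul_of_nonneg_left h1 (by positivity : 0 ≤ R * κ⁻¹)
    linarith

lemma source_left_bounds {κ a b x R v : ℝ} {ρ T : ℝ → ℝ} (hκ : 0 < κ) (ha : 0 < a)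
    (hx : x ∈ Icc (0 : ℝ) 1) (hv : 0 < v) (hρ0 : ∀ y ∈ Icc (0 : ℝ) 1, 0 < ρ y)
    (hρ : ∀ y ∈ Icc (0 : ℝ) 1, ρ y ≤ R) (hT : ∀ y ∈ Icc (0 : ℝ) 1, a ^ 2 ≤ T y ∧ T y ≤ b ^ 2) :
    0 ≤ (∫ y in (0 : ℝ)..x, (κ * v)⁻¹ * exp (-(x - y) / (κ * v)) * ρ y * Mxw (T y) v) ∧
    (∫ y in (0 : ℝ)..x, (κ * v)⁻¹ * exp (-(x - y) / (κ * v)) * ρ y * Mxw (T y) v) ≤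
      R * a⁻¹ * (1 - exp (-x / (κ * v))) ∧
    (∫ y in (0 : ℝ)..x, (κ * v)⁻¹ * exp (-(x - y) / (κ * v)) * ρ y * Mxw (T y) v) ≤
      R * κ⁻¹ / v ^ 2 * exp (-v ^ 2 / (4 * b ^ 2)) := by
  have hsub : Icc 0 x ⊆ Icc (0 : ℝ) 1 := Icc_subset_Icc le_rfl hx.2
  have hR : 0 ≤ R := (hρ0 x hx).le.trans (hρ x hx)
  have key := fun G hG => integral_source_bounds (R := R) (G := G) (ρ := ρ)
    (k := fun y => (κ * v)⁻¹ * exp (-(x - y) / (κ * v))) (M := fun y => Mxw (T y) v) hx.1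
    (by fun_prop) (fun y => by positivity) (fun y hy => (hρ0 y (hsub hy)).le)
    (fun y hy => hρ y (hsub hy)) (fun y => Mxw_nonneg _ _) hG
  simp only [integral_attenuation_left] at key
  obtain ⟨h0, h1⟩ := key a⁻¹ fun y hy => Mxw_le_inv ha (hT y (hsub hy)).1 v
  obtain ⟨-, h2⟩ := key _ fun y hy => Mxw_le_inv_mul_exp
    (lt_of_lt_of_le (by positivity) (hT y (hsub hy)).1) (hT y (hsub hy)).2 hv
  refine ⟨h0, h1, h2.trans ((mul_le_mul_of_nonneg_left
    (one_sub_exp_neg_div_le hκ hx.2 hv) (by positivity)).trans_eq ?_)⟩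
  field_simp

lemma source_right_bounds {κ a b x R v : ℝ} {ρ T : ℝ → ℝ} (hκ : 0 < κ) (ha : 0 < a)
    (hx : x ∈ Icc (0 : ℝ) 1) (hv : 0 < v) (hρ0 : ∀ y ∈ Icc (0 : ℝ) 1, 0 < ρ y)
    (hρ : ∀ y ∈ Icc (0 : ℝ) 1, ρ y ≤ R) (hT : ∀ y ∈ Icc (0 : ℝ) 1, a ^ 2 ≤ T y ∧ T y ≤ b ^ 2) :
    0 ≤ (∫ y in x..1, (κ * v)⁻¹ * exp (-(y - x) / (κ * v)) * ρ y * Mxw (T y) v) ∧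
    (∫ y in x..1, (κ * v)⁻¹ * exp (-(y - x) / (κ * v)) * ρ y * Mxw (T y) v) ≤
      R * a⁻¹ * (1 - exp (-(1 - x) / (κ * v))) ∧
    (∫ y in x..1, (κ * v)⁻¹ * exp (-(y - x) / (κ * v)) * ρ y * Mxw (T y) v) ≤
      R * κ⁻¹ / v ^ 2 * exp (-v ^ 2 / (4 * b ^ 2)) := by
  have hsub : Icc x 1 ⊆ Icc (0 : ℝ) 1 := Icc_subset_Icc hx.1 le_rfl
  have hR : 0 ≤ R := (hρ0 x hx).le.trans (hρ x hx)
  have key := fun G hG => integral_source_bounds (R := R) (G := G) (ρ := ρ)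
    (k := fun y => (κ * v)⁻¹ * exp (-(y - x) / (κ * v))) (M := fun y => Mxw (T y) v) hx.2
    (by fun_prop) (fun y => by positivity) (fun y hy => (hρ0 y (hsub hy)).le)
    (fun y hy => hρ y (hsub hy)) (fun y => Mxw_nonneg _ _) hG
  simp only [integral_attenuation_right] at key
  obtain ⟨h0, h1⟩ := key a⁻¹ fun y hy => Mxw_le_inv ha (hT y (hsub hy)).1 v
  obtain ⟨-, h2⟩ := key _ fun y hy => Mxw_le_inv_mul_exp
    (lt_of_lt_of_le (by positivity) (hT y (hsub hy)).1) (hT y (hsub hy)).2 hv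
  refine ⟨h0, h1, h2.trans ((mul_le_mul_of_nonneg_left
    (one_sub_exp_neg_div_le hκ (by linarith [hx.1]) hv) (by positivity)).trans_eq ?_)⟩
  field_simp

/-- Density and pressure carried by one half of velocity space, for a wall flux `A` and a
source `S` controlled by the density bound `R`. -/
lemma halfline_moments {κ a b t A x R δ : ℝ} (hκ : 0 < κ) (ha : 0 < a) (hat : a ≤ t)
    (hb : 0 < b) (hδ : 0 < δ) (hδ1 : δ ≤ 1) (hκδ : κ⁻¹ = a * δ ^ 2) (hA : 0 ≤ A) (hR : 0 ≤ R)
    (hx0 : 0 ≤ x) (hx1 : x ≤ 1) {F S : ℝ → ℝ} (hF : IntegrableOn F (Ioi 0))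
    (hFS : ∀ᵐ v ∂volume.restrict (Ioi 0), F v = exp (-x / (κ * v)) * wallMxw (t ^ 2) v * A + S v)
    (hS : ∀ v, 0 < v → 0 ≤ S v ∧ S v ≤ R * a⁻¹ * (1 - exp (-x / (κ * v))) ∧
      S v ≤ R * κ⁻¹ / v ^ 2 * exp (-v ^ 2 / (4 * b ^ 2))) :
    ∫ v in Ioi 0, F v ≤ A * (√(π / 2) / t) + 3 * R * δ ∧
    A * (√(π / 2) / t) * (1 - 2 * δ) ≤ ∫ v in Ioi 0, F v ∧
    IntegrableOn (fun v => v ^ 2 * F v) (Ioi 0) ∧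
    A * (√(π / 2) * t - κ⁻¹) ≤ ∫ v in Ioi 0, v ^ 2 * F v ∧
    ∫ v in Ioi 0, v ^ 2 * F v ≤ A * (√(π / 2) * t) + 2 * R * κ⁻¹ * b := by
  have ht : 0 < t := ha.trans_le hat
  have hw : ∀ v, 0 < v → exp (-x / (κ * v)) * wallMxw (t ^ 2) v * A ≤ A * wallMxw (t ^ 2) v := by
    intro v hv
    have := mul_nonneg hA (wallMxw_nonneg (pow_pos ht 2) v)
    nlinarith [exp_neg_div_le_one hκ hx0 hv]
  have h₀ : ∀ᵐ v ∂volume.restrict (Ioi 0),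
      exp (-x / (κ * v)) * wallMxw (t ^ 2) v * A ≤ F v := by
    filter_upwards [hFS, ae_restrict_mem measurableSet_Ioi] with v h hv
    linarith [(hS v hv).1]
  have h₁ : ∀ᵐ v ∂volume.restrict (Ioi 0),
      F v ≤ A * wallMxw (t ^ 2) v + R * a⁻¹ * (1 - exp (-x / (κ * v))) := by
    filter_upwards [hFS, ae_restrict_mem measurableSet_Ioi] with v h hv
    linarith [(hS v hv).2.1, hw v hv]
  have h₂ : ∀ᵐ v ∂volume.restrict (Ioi 0),
      F v ≤ A * wallMxw (t ^ 2) v + R * κ⁻¹ / v ^ 2 * exp (-v ^ 2 / (4 * b ^ 2)) := by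
    filter_upwards [hFS, ae_restrict_mem measurableSet_Ioi] with v h hv
    linarith [(hS v hv).2.2, hw v hv]
  have h₃ : ∀ᵐ v ∂volume.restrict (Ioi 0),
      F v ≤ A * wallMxw (t ^ 2) v + R * κ⁻¹ / v ^ 2 := by
    filter_upwards [h₂] with v h
    have h1 : exp (-v ^ 2 / (4 * b ^ 2)) ≤ 1 := exp_le_one_iff.2
      (div_nonpos_of_nonpos_of_nonneg (by nlinarith [sq_nonneg v]) (by positivity))
    have h2 := mul_le_mul_of_nonneg_left h1 (by positivity : 0 ≤ R * κ⁻¹ / v ^ 2)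
    linarith
  exact ⟨halfline_density_le hκ ha ht hδ hδ1 hκδ hR hx1 hF h₁ h₃,
    le_halfline_density hκ ha hat hδ hκδ hA hx1 hF h₀,
    integrableOn_sq_mul_and_bounds hκ hb ht hA hR hx1 hF h₀ h₂⟩

lemma integral_eq_Ioi_add_Ioi_neg {g : ℝ → ℝ} (h₁ : IntegrableOn g (Ioi 0))
    (h₂ : IntegrableOn (fun v => g (-v)) (Ioi 0)) :
    ∫ v, g v = (∫ v in Ioi 0, g v) + ∫ v in Ioi 0, g (-v) := by
  have h₃ : IntegrableOn g (Iic 0) := by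
    rw [integrableOn_Iic_iff_integrableOn_Iio,
      ← (Measure.measurePreserving_neg (volume : Measure ℝ)).integrableOn_comp_preimage
        (Homeomorph.neg ℝ).measurableEmbedding]
    simpa [Function.comp_def] using h₂
  rw [integral_comp_neg_Ioi, neg_zero, add_comm, intervalIntegral.integral_Iic_add_Ioi h₃ h₁]

lemma ae_restrict_Ioi_neg {p : ℝ → Prop} (h : ∀ᵐ v ∂volume.restrict (Iio (0 : ℝ)), p v) :
    ∀ᵐ v ∂volume.restrict (Ioi (0 : ℝ)), p (-v) := by
  rw [ae_restrict_iff' measurableSet_Iio] at h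
  rw [ae_restrict_iff' measurableSet_Ioi]
  filter_upwards [(Measure.measurePreserving_neg (volume : Measure ℝ)).quasiMeasurePreserving.ae h]
    with v hv hv0
  exact hv (by simpa using hv0)

lemma Cminus_nonneg {κ : ℝ} {ρ T : ℝ → ℝ} (hκ : 0 < κ) (hρ0 : ∀ y ∈ Icc (0 : ℝ) 1, 0 < ρ y) :
    0 ≤ Cminus κ ρ T :=
  mul_nonneg (by positivity) <| setIntegral_nonneg measurableSet_Icc fun y hy =>
    mul_nonneg (hρ0 y hy).le <| integral_nonneg fun v => mul_nonneg (exp_pos _).le (Mxw_nonneg _ _)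

lemma Cplus_nonneg {κ : ℝ} {ρ T : ℝ → ℝ} (hκ : 0 < κ) (hρ0 : ∀ y ∈ Icc (0 : ℝ) 1, 0 < ρ y) :
    0 ≤ Cplus κ ρ T :=
  mul_nonneg (by positivity) <| setIntegral_nonneg measurableSet_Icc fun y hy =>
    mul_nonneg (hρ0 y hy).le <| integral_nonneg fun v => mul_nonneg (exp_pos _).le (Mxw_nonneg _ _)

/-- Density and pressure bounds at a point `x`, in terms of the wall fluxes `A`, `B` and an upper
bound `R` of the density. -/
lemma moments_bounds {κ a b A B x R δ : ℝ} {ρ T g : ℝ → ℝ} (hκ : 0 < κ) (ha : 0 < a)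
    (hab : a ≤ b) (hδ : 0 < δ) (hδ1 : δ ≤ 1) (hκδ : κ⁻¹ = a * δ ^ 2) (hA : 0 ≤ A) (hB : 0 ≤ B)
    (hx : x ∈ Icc (0 : ℝ) 1) (hρ0 : ∀ y ∈ Icc (0 : ℝ) 1, 0 < ρ y)
    (hρ : ∀ y ∈ Icc (0 : ℝ) 1, ρ y ≤ R) (hT : ∀ y ∈ Icc (0 : ℝ) 1, a ^ 2 ≤ T y ∧ T y ≤ b ^ 2)
    (hρx : ρ x = ∫ v, g v)
    (hr : ∀ᵐ v ∂(volume.restrict (Ioi (0 : ℝ))),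
      g v = exp (-x / (κ * v)) * wallMxw (a ^ 2) v * A +
        ∫ y in (0 : ℝ)..x, (κ * v)⁻¹ * exp (-(x - y) / (κ * v)) * ρ y * Mxw (T y) v)
    (hl : ∀ᵐ v ∂(volume.restrict (Iio (0 : ℝ))),
      g v = exp (-(1 - x) / (κ * |v|)) * wallMxw (b ^ 2) v * B +
        ∫ y in x..1, (κ * |v|)⁻¹ * exp (-(y - x) / (κ * |v|)) * ρ y * Mxw (T y) v) :
    ρ x ≤ √(π / 2) * (A / a + B / b) + 6 * R * δ ∧
    √(π / 2) * (A / a + B / b) * (1 - 2 * δ) ≤ ρ x ∧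
    A * (√(π / 2) * a - κ⁻¹) + B * (√(π / 2) * b - κ⁻¹) ≤ ∫ v, v ^ 2 * g v ∧
    ∫ v, v ^ 2 * g v ≤ √(π / 2) * (A * a + B * b) + 4 * R * κ⁻¹ * b := by
  have hR : 0 ≤ R := (hρ0 x hx).le.trans (hρ x hx)
  have hg : Integrable g := by
    by_contra h
    exact (hρ0 x hx).ne' (hρx.trans (integral_undef h))
  have hl' : ∀ᵐ v ∂(volume.restrict (Ioi (0 : ℝ))),
      g (-v) = exp (-(1 - x) / (κ * v)) * wallMxw (b ^ 2) v * B +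
        ∫ y in x..1, (κ * v)⁻¹ * exp (-(y - x) / (κ * v)) * ρ y * Mxw (T y) v := by
    filter_upwards [ae_restrict_Ioi_neg hl, ae_restrict_mem measurableSet_Ioi] with v h hv
    have hv : 0 < v := hv
    simpa only [abs_neg, abs_of_pos hv, wallMxw_neg, Mxw_neg] using h
  obtain ⟨p1, p2, p3, p4, p5⟩ := halfline_moments hκ ha le_rfl (ha.trans_le hab) hδ hδ1 hκδ hA hR
    hx.1 hx.2 hg.integrableOn hr fun v hv => source_left_bounds hκ ha hx hv hρ0 hρ hT
  obtain ⟨q1, q2, q3, q4, q5⟩ := halfline_moments hκ ha hab (ha.trans_le hab) hδ hδ1 hκδ hB hR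
    (by linarith [hx.2]) (by linarith [hx.1]) hg.comp_neg.integrableOn hl'
    fun v hv => source_right_bounds hκ ha hx hv hρ0 hρ hT
  have e1 := integral_eq_Ioi_add_Ioi_neg hg.integrableOn hg.comp_neg.integrableOn
  have e2 := integral_eq_Ioi_add_Ioi_neg (g := fun v => v ^ 2 * g v) p3
    (by simpa only [neg_sq] using q3)
  simp only [neg_sq] at e2
  have e3 : √(π / 2) * (A / a + B / b) = A * (√(π / 2) / a) + B * (√(π / 2) / b) := by ring
  rw [hρx, e1, e2, e3]
  refine ⟨?_, ?_, ?_, ?_⟩ <;> linarith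

lemma pressure_le_sq_mul_density {a b A B R δ s r P : ℝ} (ha : 0 < a) (hδ : 0 < δ)
    (hδ1 : δ ≤ 1 / 12) (hs : 0 < s) (hA : 0 ≤ A) (hB : 0 ≤ B) (hab : a ≤ b * (1 - 40 * δ))
    (hb : 0 < b) (hBA : B ≤ 2 * A) (hR : R ≤ 2 * s * (A / a + B / b))
    (hr : s * (A / a + B / b) * (1 - 2 * δ) ≤ r)
    (hP : P ≤ s * (A * a + B * b) + 4 * R * (a * δ ^ 2) * b) : P ≤ b ^ 2 * r := by
  have hab' : a ≤ b := by nlinarith [mul_pos hb hδ]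
  have h1 : 4 * R * (a * δ ^ 2) * b ≤ 8 * s * δ ^ 2 * (A * b + B * a) := by
    calc 4 * R * (a * δ ^ 2) * b ≤ 4 * (2 * s * (A / a + B / b)) * (a * δ ^ 2) * b := by gcongr
      _ = _ := by field_simp; ring
  have h2 : b ^ 2 * (s * (A / a + B / b) * (1 - 2 * δ)) ≤ b ^ 2 * r := by gcongr
  refine le_trans (hP.trans ?_) h2
  have h3 : b ^ 2 * (s * (A / a + B / b) * (1 - 2 * δ)) =
      s * ((A * b ^ 2 + B * a * b) / a) * (1 - 2 * δ) := by field_simp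
  have hd2 : δ ^ 2 ≤ δ := by nlinarith
  have h4 : 8 * δ ^ 2 * (A * b + B * a) * a ≤ 24 * δ * (A * b ^ 2) := by
    have u1 : A * b + B * a ≤ A * b + 2 * A * b := by gcongr
    have u2 : 0 ≤ A * b + B * a := by positivity
    calc 8 * δ ^ 2 * (A * b + B * a) * a ≤ 8 * δ * (A * b + 2 * A * b) * b := by gcongr
      _ = _ := by ring
  have h5 : 2 * δ * (A * b ^ 2 + B * a * b) ≤ 6 * δ * (A * b ^ 2) := by
    have : A * b ^ 2 + B * a * b ≤ A * b ^ 2 + 2 * A * b * b := by gcongr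
    calc _ ≤ 2 * δ * (A * b ^ 2 + 2 * A * b * b) := by gcongr
      _ = _ := by ring
  have h6 : 40 * δ * (A * b ^ 2) ≤ A * (b ^ 2 - a ^ 2) := by
    have : 40 * δ * b ^ 2 ≤ b ^ 2 - a ^ 2 := by nlinarith
    nlinarith
  have h7 : 0 ≤ δ * (A * b ^ 2) := by positivity
  have h8 : (A * a + B * b + 8 * δ ^ 2 * (A * b + B * a)) * a ≤
      (A * b ^ 2 + B * a * b) * (1 - 2 * δ) := by linarith
  rw [← le_div_iff₀ ha] at h8
  have h9 := mul_le_mul_of_nonneg_left h8 hs.le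
  have h10 : s * ((A * b ^ 2 + B * a * b) * (1 - 2 * δ) / a) =
    s * ((A * b ^ 2 + B * a * b) / a) * (1 - 2 * δ) := by ring
  linarith

lemma sq_mul_density_le_pressure {a b A B R δ s r P : ℝ} (ha : 0 < a) (hδ : 0 < δ)
    (hδ1 : δ ≤ 1 / 12) (hs : 1 ≤ s) (hA : 0 ≤ A) (hB : 0 ≤ B) (hab : a ≤ b * (1 - 40 * δ))
    (hb : 0 < b) (hAB : A ≤ 2 * B) (hR : R ≤ 2 * s * (A / a + B / b))
    (hr : r ≤ s * (A / a + B / b) + 6 * R * δ)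
    (hP : A * (s * a - a * δ ^ 2) + B * (s * b - a * δ ^ 2) ≤ P) : a ^ 2 * r ≤ P := by
  have hab' : a ≤ b := by nlinarith [mul_pos hb hδ]
  have hd2 : δ ^ 2 ≤ δ := by nlinarith
  have h1 : a ^ 2 * r ≤ s * (1 + 12 * δ) * (A * a + B * (a ^ 2 / b)) := by
    calc a ^ 2 * r ≤ a ^ 2 * (s * (A / a + B / b) + 6 * (2 * s * (A / a + B / b)) * δ) := by
          refine mul_le_mul_of_nonneg_left (hr.trans ?_) (by positivity)
          gcongr
      _ = _ := by field_simp; ring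
  have h2 : s * (1 - δ) * (A * a + B * b) ≤ P := by
    have u1 : a * δ ^ 2 ≤ s * a * δ := by
      calc a * δ ^ 2 ≤ a * δ := by gcongr
        _ = 1 * (a * δ) := by ring
        _ ≤ s * (a * δ) := by gcongr
        _ = _ := by ring
    have u2 : s * a * δ ≤ s * b * δ := by gcongr
    have u3 := mul_le_mul_of_nonneg_left u1 hA
    have u4 := mul_le_mul_of_nonneg_left (u1.trans u2) hB
    linarith
  refine h1.trans (le_trans ?_ h2)
  rw [mul_assoc, mul_assoc]
  refine mul_le_mul_of_nonneg_left ?_ (by linarith)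
  have h3 : a ^ 2 / b ≤ a := by rw [div_le_iff₀ hb]; nlinarith
  have h4 : A * a ≤ 2 * B * b := by gcongr
  have h5 : B * (a ^ 2 / b) ≤ B * a := by gcongr
  have h6 : B * a ≤ B * b := by gcongr
  have h7 : B * a ≤ B * (b * (1 - 40 * δ)) := by gcongr
  have h8 := mul_le_mul_of_nonneg_left h4 hδ.le
  have h9 := mul_le_mul_of_nonneg_left (h5.trans h6) hδ.le
  linarith

lemma temperature_bounds {κ a b δ : ℝ} {ρ T : ℝ → ℝ} {f : ℝ → ℝ → ℝ} (hκ : 0 < κ) (ha : 0 < a)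
    (hb : 0 < b) (hδ : 0 < δ) (hδ1 : δ ≤ 1 / 12) (hκδ : κ⁻¹ = a * δ ^ 2)
    (hab : a ≤ b * (1 - 40 * δ)) (hρ0 : ∀ y ∈ Icc (0 : ℝ) 1, 0 < ρ y)
    (hρ : ∃ B : ℝ, ∀ y ∈ Icc (0 : ℝ) 1, ρ y ≤ B)
    (hT : ∀ y ∈ Icc (0 : ℝ) 1, a ^ 2 ≤ T y ∧ T y ≤ b ^ 2)
    (hf : IsMildSteadyState κ (a ^ 2) (b ^ 2) ρ T f) {x : ℝ} (hx : x ∈ Icc (0 : ℝ) 1) :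
    a ^ 2 * ρ x ≤ (∫ v, v ^ 2 * f x v) ∧ (∫ v, v ^ 2 * f x v) ≤ b ^ 2 * ρ x := by
  obtain ⟨hC, -, -, hfρ, hfx⟩ := hf
  have hab' : a ≤ b := by nlinarith [mul_pos hb hδ]
  have hCa : 1 / 2 ≤ Cwall κ (a ^ 2) ∧ 1 / 2 ≤ Cwall κ (b ^ 2) := by
    have h : ∀ t, a ≤ t → 1 / 2 ≤ Cwall κ (t ^ 2) := fun t hat => by
      refine le_trans ?_ (Cwall_ge hκ (ha.trans_le hat))
      have h1 : a * δ ^ 2 * (√(π / 2) / t) ≤ t * δ ^ 2 * (2 / t) := by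
        have := ha.trans_le hat
        gcongr
        exact sqrt_pi_div_two_le_two
      have h2 : t * δ ^ 2 * (2 / t) = 2 * δ ^ 2 := by
        have := (ha.trans_le hat).ne'
        field_simp
      rw [hκδ]
      nlinarith
    exact ⟨h a le_rfl, h b hab'⟩
  have hm := Cminus_nonneg (T := T) hκ hρ0
  have hp := Cplus_nonneg (T := T) hκ hρ0
  set c₁ := Cwall κ (a ^ 2)
  set c₂ := Cwall κ (b ^ 2)
  have hD : 0 < 1 - c₁ * c₂ := by linarith
  have hc₁ : 0 < c₁ := by linarith [hCa.1]
  have hc₂ : 0 < c₂ := by linarith [hCa.2]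
  set A := (Cminus κ ρ T + c₂ * Cplus κ ρ T) / (1 - c₁ * c₂)
  set B := (Cplus κ ρ T + c₁ * Cminus κ ρ T) / (1 - c₁ * c₂)
  have hA0 : 0 ≤ A := by positivity
  have hB0 : 0 ≤ B := by positivity
  have hD' := hD.ne'
  have hAD : A * (1 - c₁ * c₂) = Cminus κ ρ T + c₂ * Cplus κ ρ T := div_mul_cancel₀ _ hD'
  have hBD : B * (1 - c₁ * c₂) = Cplus κ ρ T + c₁ * Cminus κ ρ T := div_mul_cancel₀ _ hD'
  have eA : A = Cminus κ ρ T + c₂ * B :=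
    mul_right_cancel₀ hD' (by linear_combination hAD - c₂ * hBD)
  have eB : B = Cplus κ ρ T + c₁ * A :=
    mul_right_cancel₀ hD' (by linear_combination hBD - c₁ * hAD)
  have hBA : B ≤ 2 * A := by nlinarith [mul_le_mul_of_nonneg_right hCa.2 hB0]
  have hAB : A ≤ 2 * B := by nlinarith [mul_le_mul_of_nonneg_right hCa.1 hA0]
  have hne : (image ρ (Icc (0 : ℝ) 1)).Nonempty := ⟨_, mem_image_of_mem ρ hx⟩
  have hbdd : BddAbove (image ρ (Icc (0 : ℝ) 1)) := by
    obtain ⟨K, hK⟩ := hρ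
    exact ⟨K, by rintro _ ⟨y, hy, rfl⟩; exact hK y hy⟩
  set R := sSup (image ρ (Icc (0 : ℝ) 1))
  have hρR : ∀ y ∈ Icc (0 : ℝ) 1, ρ y ≤ R := fun y hy => le_csSup hbdd (mem_image_of_mem ρ hy)
  have hb4 := fun y (hy : y ∈ Icc (0 : ℝ) 1) => moments_bounds hκ ha hab' hδ (by linarith) hκδ
    hA0 hB0 hy hρ0 hρR hT (hfρ y hy) (hfx y hy).1 (hfx y hy).2
  have hR0 : 0 ≤ R := (hρ0 x hx).le.trans (hρR x hx)
  have hR : R ≤ 2 * √(π / 2) * (A / a + B / b) := by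
    have h : R ≤ √(π / 2) * (A / a + B / b) + 6 * R * δ :=
      csSup_le hne (by rintro _ ⟨y, hy, rfl⟩; exact (hb4 y hy).1)
    have := mul_le_mul_of_nonneg_left hδ1 hR0
    linarith
  obtain ⟨h1, h2, h3, h4⟩ := hb4 x hx
  rw [hκδ] at h3 h4
  exact ⟨sq_mul_density_le_pressure ha hδ hδ1 one_le_sqrt_pi_div_two hA0 hB0 hab hb hAB hR h1 h3,
    pressure_le_sq_mul_density ha hδ hδ1 (by linarith [one_le_sqrt_pi_div_two]) hA0 hB0 hab hb
      hBA hR h2 h4⟩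

/-- the interval of temperatures `[T₁, T₂]` is preserved by the map `T ↦ τ`. -/
theorem temperature_interval_preserved :
    ∃ Θ γ₀ γ₁ : ℝ, 1 ≤ Θ ∧ 0 < γ₀ ∧ 0 < γ₁ ∧
      ∀ κ T₁ T₂ : ℝ, 0 < κ → 0 < T₁ → 0 < T₂ → Θ ≤ κ ^ 2 * T₁ → T₁ ≤ T₂ →
        Real.sqrt (T₁ * T₂) * (1 + γ₀ * (κ ^ 2 * T₁) ^ (-(1 : ℝ) / 4)) ≤ T₂ →
        T₁ ≤ Real.sqrt (T₁ * T₂) * (1 - γ₁ * (κ ^ 2 * T₁) ^ (-(1 : ℝ) / 4)) →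
        ∀ ρ T : ℝ → ℝ, Measurable ρ → (∀ y ∈ Icc (0 : ℝ) 1, 0 < ρ y) →
          (∃ B : ℝ, ∀ y ∈ Icc (0 : ℝ) 1, ρ y ≤ B) →
          (∫ y in Icc (0 : ℝ) 1, ρ y) = 1 →
          Measurable T → (∀ y, 0 < T y) →
          (∀ y ∈ Icc (0 : ℝ) 1, T₁ ≤ T y ∧ T y ≤ T₂) →
          ∀ f : ℝ → ℝ → ℝ, (∀ x v, 0 ≤ f x v) →
            IsMildSteadyState κ T₁ T₂ ρ T f →
            (∀ x₁ ∈ Icc (0 : ℝ) 1, ∀ x₂ ∈ Icc (0 : ℝ) 1,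
              (∫ v, v ^ 2 * f x₁ v) = ∫ v, v ^ 2 * f x₂ v) →
            ∀ x ∈ Icc (0 : ℝ) 1,
              T₁ ≤ (∫ v, v ^ 2 * f x v) / ρ x ∧ (∫ v, v ^ 2 * f x v) / ρ x ≤ T₂ := by
  refine ⟨12 ^ 4, 1, 40, by norm_num, one_pos, by norm_num, ?_⟩
  intro κ T₁ T₂ hκ hT₁ hT₂ hΘ _ _ hγ₁ ρ T _ hρ0 hρ _ _ _ hT f _ hf _ x hx
  obtain ⟨a, ha, rfl⟩ : ∃ a : ℝ, 0 < a ∧ a ^ 2 = T₁ := ⟨√T₁, sqrt_pos.2 hT₁, sq_sqrt hT₁.le⟩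
  obtain ⟨b, hb, rfl⟩ : ∃ b : ℝ, 0 < b ∧ b ^ 2 = T₂ := ⟨√T₂, sqrt_pos.2 hT₂, sq_sqrt hT₂.le⟩
  obtain ⟨c, hc, hc4⟩ : ∃ c : ℝ, 0 < c ∧ c ^ 4 = κ ^ 2 * a ^ 2 := by
    refine ⟨(κ ^ 2 * a ^ 2) ^ (1 / 4 : ℝ), by positivity, ?_⟩
    rw [← rpow_natCast, ← rpow_mul (by positivity)]
    norm_num
  have hδ : (κ ^ 2 * a ^ 2) ^ (-(1 : ℝ) / 4) = c⁻¹ := by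
    rw [← hc4, ← rpow_natCast, ← rpow_mul hc.le]
    norm_num [rpow_neg_one]
  have hc12 : 12 ≤ c := by
    rw [← hc4] at hΘ
    exact le_of_pow_le_pow_left₀ (by norm_num) hc.le hΘ
  have hc2 : c ^ 2 = κ * a := by
    rw [← sq_eq_sq₀ (by positivity) (by positivity)]
    linear_combination hc4
  have hκδ : κ⁻¹ = a * c⁻¹ ^ 2 := by
    rw [inv_pow, hc2]
    field_simp
  have hab : a ≤ b * (1 - 40 * c⁻¹) := by
    rw [hδ, ← mul_pow, sqrt_sq (by positivity)] at hγ₁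
    nlinarith
  have hc1 : c⁻¹ ≤ 1 / 12 := by
    rw [one_div]
    gcongr
  have h := temperature_bounds hκ ha hb (inv_pos.2 hc) hc1 hκδ hab hρ0 hρ hT hf hx
  exact ⟨(le_div_iff₀ (hρ0 x hx)).2 h.1, (div_le_iff₀ (hρ0 x hx)).2 h.2⟩
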